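/- arXiv:1809.05870 — 3 statements merged into one kernel-verified Lean document; each statement's English description precedes it below -/
import Mathlib

section
/- (Remainder-term bound, Lipschitz case.) Consider the Kalman filter recursions for (G, F, v, W): n ≥ 1, G a real n×n matrix, F ∈ ℝⁿ, v > 0, W a symmetric positive definite n×n matrix; given a symmetric positive semidefinite initial covariance C_0, define for t ≥ 1: R_t = G C_{t−1} Gᵀ + W, Q_t = ⟨F, R_t F⟩ + v, A_t = R_t F/Q_t, C_t = R_t − Q_t A_t A_tᵀ, and Z_t = G(I − A_t Fᵀ). Assume R_t converges (entrywise) as t → ∞ to a symmetric positive semidefinite matrix R satisfying the Riccati fixed-point equation R = G(R − (R F)(R F)ᵀ/(⟨F, R F⟩ + v))Gᵀ + W. Fix a_1 ∈ ℝⁿ and B_1 > 0. Then there exist ρ' with 0 < ρ' < 1 and constants c_1, c_2 ≥ 0 such that: for every real sequence (Y_t)_{t≥0} with |Y_{t+1} − Y_t| ≤ B_1 for all t ≥ 0 and |Y_0| ≤ B_1, defining a_{t+1} = Y_t·G A_t + Z_t a_t for t ≥ 1, one has for all integers s > 0 and t > s: |⟨F, (Z_t Z_{t−1} ⋯ Z_{t−s})·a_{t−s}⟩|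 ≤ (ρ')ˢ·c_1·(|Y_t| + s·B_1 + c_2). -/
open Matrix Filter Topology BigOperators

/-- Quadratic form of a symmetric Kalman step (Joseph form). -/
lemma joseph_form {n : ℕ} (G W R C Z R' : Matrix (Fin n) (Fin n) ℝ) (F A : Fin n → ℝ)
    (v Q : ℝ) (hsym : Rᵀ = R) (hQ : Q = F ⬝ᵥ (R *ᵥ F) + v) (hQ0 : Q ≠ 0)
    (hA : A = Q⁻¹ • (R *ᵥ F)) (hC : C = R - Q • vecMulVec A A)
    (hZ : Z = G * (1 - vecMulVec A F)) (hR' : R' = G * C * Gᵀ + W) (x : Fin n → ℝ) :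
    x ⬝ᵥ (R' *ᵥ x) = (x ᵥ* Z) ⬝ᵥ (R *ᵥ (x ᵥ* Z)) + v * (x ⬝ᵥ (G *ᵥ A)) ^ 2 + x ⬝ᵥ (W *ᵥ x) := by
  have hRF : R *ᵥ F = Q • A := by rw [hA, smul_smul, mul_inv_cancel₀ hQ0, one_smul]
  obtain ⟨y, hy⟩ : ∃ y, y = x ᵥ* G := ⟨_, rfl⟩
  have hxGA : x ⬝ᵥ (G *ᵥ A) = y ⬝ᵥ A := by rw [dotProduct_mulVec, hy]
  have hxZ : x ᵥ* Z = y - (y ⬝ᵥ A) • F := by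
    rw [hZ, ← vecMul_vecMul, ← hy, vecMul_sub, vecMul_one, vecMul_vecMulVec]
  have hFR : F ⬝ᵥ (R *ᵥ y) = Q * (y ⬝ᵥ A) := by
    rw [dotProduct_mulVec, ← mulVec_transpose, hsym, hRF, smul_dotProduct, dotProduct_comm,
      smul_eq_mul]
  have hFRF : Q * (F ⬝ᵥ A) = Q - v := by
    have h := hQ
    rw [hRF, dotProduct_smul, smul_eq_mul] at h
    linarith
  have hl : x ⬝ᵥ ((G * C * Gᵀ) *ᵥ x) = y ⬝ᵥ (R *ᵥ y) - Q * (y ⬝ᵥ A) ^ 2 := by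
    have h1 : (G * C * Gᵀ) *ᵥ x = G *ᵥ (C *ᵥ y) := by
      rw [← mulVec_mulVec, ← mulVec_mulVec, mulVec_transpose, hy]
    rw [h1, dotProduct_mulVec, ← hy, hC, sub_mulVec, dotProduct_sub, smul_mulVec,
      vecMulVec_mulVec, dotProduct_smul]
    simp only [dotProduct_smul, smul_eq_mul, MulOpposite.smul_eq_mul_unop, MulOpposite.unop_op]
    rw [dotProduct_comm A y]
    ring
  rw [hR', add_mulVec, dotProduct_add, hl, hxGA, hxZ]
  simp only [mulVec_sub, mulVec_smul, hRF, sub_dotProduct, dotProduct_sub, smul_dotProduct,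
    dotProduct_smul, smul_eq_mul, hFR]
  linear_combination -(y ⬝ᵥ A) ^ 2 * hFRF

lemma posdef_lower {n : ℕ} (hn : 1 ≤ n) (W : Matrix (Fin n) (Fin n) ℝ) (hW : W.PosDef) :
    ∃ w : ℝ, 0 < w ∧ ∀ x : Fin n → ℝ, w * ‖x‖ ^ 2 ≤ x ⬝ᵥ (W *ᵥ x) := by
  haveI : Nonempty (Fin n) := ⟨⟨0, hn⟩⟩
  have hcont : Continuous fun x : Fin n → ℝ => x ⬝ᵥ (W *ᵥ x) := by
    unfold dotProduct mulVec dotProduct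
    fun_prop
  obtain ⟨x0, hx0, hmin⟩ := (isCompact_sphere (0 : Fin n → ℝ) 1).exists_isMinOn
    (NormedSpace.sphere_nonempty.2 zero_le_one) hcont.continuousOn
  have hx0' : ‖x0‖ = 1 := by simpa using hx0
  have hne : x0 ≠ 0 := by
    intro h
    rw [h] at hx0'
    simp at hx0'
  refine ⟨x0 ⬝ᵥ (W *ᵥ x0), by simpa using hW.dotProduct_mulVec_pos hne, fun x => ?_⟩
  by_cases hx : x = 0
  · simp [hx]
  have hxn : ‖x‖ ≠ 0 := norm_ne_zero_iff.2 hx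
  have h := hmin (a := ‖x‖⁻¹ • x) (by simp [norm_smul, hxn])
  simp only [Set.mem_setOf_eq, mulVec_smul, smul_dotProduct, dotProduct_smul, smul_eq_mul] at h
  calc x0 ⬝ᵥ (W *ᵥ x0) * ‖x‖ ^ 2
      ≤ (‖x‖⁻¹ * (‖x‖⁻¹ * (x ⬝ᵥ (W *ᵥ x)))) * ‖x‖ ^ 2 := by gcongr
    _ = x ⬝ᵥ (W *ᵥ x) := by field_simp

lemma dot_le_norm {n : ℕ} (x y : Fin n → ℝ) : |x ⬝ᵥ y| ≤ n * ‖x‖ * ‖y‖ := by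
  unfold dotProduct
  calc |∑ i, x i * y i| ≤ ∑ i, |x i * y i| := Finset.abs_sum_le_sum_abs _ _
    _ ≤ ∑ _i : Fin n, ‖x‖ * ‖y‖ := by
      refine Finset.sum_le_sum fun i _ => ?_
      rw [abs_mul]
      exact mul_le_mul (norm_le_pi_norm x i) (norm_le_pi_norm y i) (abs_nonneg _) (norm_nonneg _)
    _ = n * ‖x‖ * ‖y‖ := by simp [mul_assoc]

lemma quad_upper {n : ℕ} (R : ℕ → Matrix (Fin n) (Fin n) ℝ) (L : Matrix (Fin n) (Fin n) ℝ)
    (h : ∀ i j, Tendsto (fun t => R t i j) atTop (nhds (L i j))) :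
    ∃ r : ℝ, 0 ≤ r ∧ ∀ t, ∀ x : Fin n → ℝ, x ⬝ᵥ (R t *ᵥ x) ≤ r * ‖x‖ ^ 2 := by
  have hb : ∀ i j, ∃ b : ℝ, ∀ t, |R t i j| ≤ b := by
    intro i j
    obtain ⟨b, hb⟩ := (h i j).abs.bddAbove_range
    exact ⟨b, fun t => hb ⟨t, rfl⟩⟩
  choose b hb using hb
  have hb0 : ∀ i j, 0 ≤ b i j := fun i j => (abs_nonneg _).trans (hb i j 0)
  refine ⟨∑ i, ∑ j, b i j, Finset.sum_nonneg fun i _ => Finset.sum_nonneg fun j _ => hb0 i j,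
    fun t x => ?_⟩
  unfold mulVec dotProduct
  rw [Finset.sum_mul]
  refine Finset.sum_le_sum fun i _ => ?_
  change x i * (∑ j, R t i j * x j) ≤ _
  rw [Finset.sum_mul, Finset.mul_sum]
  refine Finset.sum_le_sum fun j _ => (le_abs_self _).trans ?_
  rw [abs_mul, abs_mul]
  have h1 : |x i| ≤ ‖x‖ := norm_le_pi_norm x i
  have h2 : |x j| ≤ ‖x‖ := norm_le_pi_norm x j
  calc |x i| * (|R t i j| * |x j|) ≤ ‖x‖ * (b i j * ‖x‖) := by
        gcongr
        · exact hb0 i j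
        · exact hb i j t
    _ = b i j * ‖x‖ ^ 2 := by ring

/-- Remainder-term bound, Lipschitz case: For the Kalman filter recursions
`R_t = G C_{t−1} Gᵀ + W`, `Q_t = ⟨F, R_t F⟩ + v`, `A_t = R_t F/Q_t`,
`C_t = R_t − Q_t A_t A_tᵀ`, `Z_t = G(I − A_t Fᵀ)` (for `t ≥ 1`, with `C_0` a symmetric
positive semidefinite initial covariance), `W` symmetric positive definite, `v > 0`,
assuming `R_t → R` entrywise with `R` a symmetric positive semidefinite solution of the
Riccati fixed-point equation: for any fixed `a_1` and bound `B_1 > 0` there exist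
`ρ' ∈ (0,1)` and `c₁, c₂ ≥ 0` such that for every sequence `Y` with
`|Y_{t+1} − Y_t| ≤ B_1` and `|Y_0| ≤ B_1`, with `a_{t+1} = Y_t·G A_t + Z_t a_t` for
`t ≥ 1`, one has for all `0 < s < t`:
`|⟨F, (Z_t Z_{t−1} ⋯ Z_{t−s})·a_{t−s}⟩| ≤ (ρ')ˢ·c₁·(|Y_t| + s·B_1 + c₂)`. -/
theorem stmt_10 {n : ℕ} (hn : 1 ≤ n) (G W C0 : Matrix (Fin n) (Fin n) ℝ)
    (F a1 : Fin n → ℝ) (v : ℝ) (hv : 0 < v) (hW : W.PosDef) (hC0 : C0.PosSemidef)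
    (Rm Cm : ℕ → Matrix (Fin n) (Fin n) ℝ) (Qm : ℕ → ℝ)
    (Am : ℕ → Fin n → ℝ) (Zm : ℕ → Matrix (Fin n) (Fin n) ℝ)
    (hCm0 : Cm 0 = C0)
    (hRm : ∀ t, Rm (t + 1) = G * Cm t * Gᵀ + W)
    (hQm : ∀ t, Qm (t + 1) = F ⬝ᵥ (Rm (t + 1) *ᵥ F) + v)
    (hAm : ∀ t, Am (t + 1) = (Qm (t + 1))⁻¹ • (Rm (t + 1) *ᵥ F))
    (hCm : ∀ t, Cm (t + 1) =
      Rm (t + 1) - Qm (t + 1) • vecMulVec (Am (t + 1)) (Am (t + 1)))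
    (hZm : ∀ t, Zm (t + 1) = G * (1 - vecMulVec (Am (t + 1)) F))
    (R : Matrix (Fin n) (Fin n) ℝ)
    (hconv : ∀ i j, Tendsto (fun t => Rm t i j) atTop (nhds (R i j)))
    (hR : R.PosSemidef)
    (hRic : R = G * (R - (F ⬝ᵥ (R *ᵥ F) + v)⁻¹ • vecMulVec (R *ᵥ F) (R *ᵥ F)) * Gᵀ + W)
    (B1 : ℝ) (hB1 : 0 < B1) :
    ∃ ρ' c₁ c₂ : ℝ, 0 < ρ' ∧ ρ' < 1 ∧ 0 ≤ c₁ ∧ 0 ≤ c₂ ∧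
      ∀ Y : ℕ → ℝ, (∀ t, |Y (t + 1) - Y t| ≤ B1) → |Y 0| ≤ B1 →
      ∀ a : ℕ → Fin n → ℝ, a 1 = a1 →
        (∀ t, 1 ≤ t → a (t + 1) = Y t • (G *ᵥ Am t) + Zm t *ᵥ a t) →
      ∀ s t : ℕ, 0 < s → s < t →
        |F ⬝ᵥ ((((List.range (s + 1)).map fun i => Zm (t - i)).prod) *ᵥ a (t - s))|
          ≤ ρ' ^ s * c₁ * (|Y t| + s * B1 + c₂) := by
  obtain ⟨w, hw, hWl⟩ := posdef_lower hn W hW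
  obtain ⟨r0, hr0, hRu0⟩ := quad_upper Rm R hconv
  obtain ⟨r, hr⟩ : ∃ r, r = r0 + w + 1 := ⟨_, rfl⟩
  have hrpos : 0 < r := by linarith
  have hRu : ∀ t, ∀ x : Fin n → ℝ, x ⬝ᵥ (Rm t *ᵥ x) ≤ r * ‖x‖ ^ 2 := fun t x =>
    (hRu0 t x).trans (mul_le_mul_of_nonneg_right (by linarith) (by positivity))
  have hWT : Wᵀ = W := by simpa using hW.isHermitian.eq
  have hCT : C0ᵀ = C0 := by simpa using hC0.isHermitian.eq
  -- symmetry
  have hsymC : ∀ t, (Cm t)ᵀ = Cm t := by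
    intro t
    induction t with
    | zero => rw [hCm0, hCT]
    | succ t ih =>
      have hRs : (Rm (t + 1))ᵀ = Rm (t + 1) := by
        rw [hRm]
        simp [transpose_mul, ih, hWT, Matrix.mul_assoc]
      rw [hCm, transpose_sub, transpose_smul, hRs, transpose_vecMulVec]
  have hsymR : ∀ t, (Rm (t + 1))ᵀ = Rm (t + 1) := by
    intro t
    rw [hRm]
    simp [transpose_mul, hsymC, hWT, Matrix.mul_assoc]
  have hQ0 : ∀ t, (∀ x : Fin n → ℝ, 0 ≤ x ⬝ᵥ (Rm (t + 1) *ᵥ x)) → Qm (t + 1) ≠ 0 := by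
    intro t h
    have := h F
    rw [hQm]
    positivity
  have hJ0 : ∀ t, Qm (t + 1) ≠ 0 → ∀ x : Fin n → ℝ, x ⬝ᵥ (Rm (t + 1 + 1) *ᵥ x) =
      (x ᵥ* Zm (t + 1)) ⬝ᵥ (Rm (t + 1) *ᵥ (x ᵥ* Zm (t + 1)))
        + v * (x ⬝ᵥ (G *ᵥ Am (t + 1))) ^ 2 + x ⬝ᵥ (W *ᵥ x) := fun t hq x =>
    joseph_form G W (Rm (t + 1)) (Cm (t + 1)) _ _ F (Am (t + 1)) v (Qm (t + 1)) (hsymR t)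
      (hQm t) hq (hAm t) (hCm t) (hZm t) (hRm (t + 1)) x
  have hWnn : ∀ x : Fin n → ℝ, 0 ≤ x ⬝ᵥ (W *ᵥ x) := fun x =>
    le_trans (by positivity) (hWl x)
  have hV1 : ∀ x : Fin n → ℝ, x ⬝ᵥ (W *ᵥ x) ≤ x ⬝ᵥ (Rm 1 *ᵥ x) := by
    intro x
    have h := hC0.dotProduct_mulVec_nonneg (x ᵥ* G)
    have h1 : (G * Cm 0 * Gᵀ) *ᵥ x = G *ᵥ (C0 *ᵥ (x ᵥ* G)) := by
      rw [← mulVec_mulVec, ← mulVec_mulVec, mulVec_transpose, hCm0]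
    have h2 : Rm 1 = G * Cm 0 * Gᵀ + W := hRm 0
    rw [h2, add_mulVec, dotProduct_add, h1, dotProduct_mulVec x G]
    have h3 : 0 ≤ (x ᵥ* G) ⬝ᵥ (C0 *ᵥ (x ᵥ* G)) := by simpa using h
    linarith
  have hVnn : ∀ t, ∀ x : Fin n → ℝ, 0 ≤ x ⬝ᵥ (Rm (t + 1) *ᵥ x) := by
    intro t
    induction t with
    | zero => exact fun x => (hWnn x).trans (hV1 x)
    | succ t ih =>
      intro x
      rw [hJ0 t (hQ0 t ih) x]
      have := ih (x ᵥ* Zm (t + 1))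
      have := hWnn x
      positivity
  have hJ : ∀ t, ∀ x : Fin n → ℝ, x ⬝ᵥ (Rm (t + 1 + 1) *ᵥ x) =
      (x ᵥ* Zm (t + 1)) ⬝ᵥ (Rm (t + 1) *ᵥ (x ᵥ* Zm (t + 1)))
        + v * (x ⬝ᵥ (G *ᵥ Am (t + 1))) ^ 2 + x ⬝ᵥ (W *ᵥ x) := fun t => hJ0 t (hQ0 t (hVnn t))
  -- the Lyapunov norm
  obtain ⟨S, hS⟩ : ∃ S : ℕ → (Fin n → ℝ) → ℝ, ∀ t x, S t x = √(x ⬝ᵥ (Rm t *ᵥ x)) :=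
    ⟨_, fun _ _ => rfl⟩
  have hS0 : ∀ t x, 0 ≤ S t x := fun t x => by rw [hS]; positivity
  obtain ⟨q, hq⟩ : ∃ q, q = 1 - w / r := ⟨_, rfl⟩
  have hwr : w / r < 1 := by rw [div_lt_one hrpos]; linarith
  have hwr0 : 0 < w / r := by positivity
  have hqpos : 0 < q := by linarith
  have hq1 : q < 1 := by linarith
  obtain ⟨ρ, hρ⟩ : ∃ ρ, ρ = √q := ⟨_, rfl⟩
  have hρ0 : 0 < ρ := by rw [hρ]; positivity
  have hρ1 : ρ < 1 := by rw [hρ, Real.sqrt_lt' one_pos]; simpa using hq1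
  have hcontr : ∀ t, 1 ≤ t → ∀ x, S t (x ᵥ* Zm t) ≤ ρ * S (t + 1) x := by
    intro t ht x
    obtain ⟨t, rfl⟩ := Nat.exists_eq_add_of_le' ht
    rw [hS, hS, hρ, ← Real.sqrt_mul hqpos.le]
    apply Real.sqrt_le_sqrt
    have h1 := hJ t x
    have h2 := hRu (t + 1 + 1) x
    have h3 := hWl x
    have h4 : w / r * (x ⬝ᵥ (Rm (t + 1 + 1) *ᵥ x)) ≤ w * ‖x‖ ^ 2 := by
      calc _ ≤ w / r * (r * ‖x‖ ^ 2) := by gcongr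
        _ = _ := by field_simp
    have h5 : 0 ≤ v * (x ⬝ᵥ (G *ᵥ Am (t + 1))) ^ 2 := by positivity
    rw [hq, sub_mul, one_mul]
    linarith
  obtain ⟨κ, hκ⟩ : ∃ κ, κ = (√v)⁻¹ := ⟨_, rfl⟩
  have hκ0 : 0 < κ := by rw [hκ]; positivity
  have hgain : ∀ t, 1 ≤ t → ∀ x, |x ⬝ᵥ (G *ᵥ Am t)| ≤ κ * S (t + 1) x := by
    intro t ht x
    obtain ⟨t, rfl⟩ := Nat.exists_eq_add_of_le' ht
    rw [hS, hκ, ← Real.sqrt_inv, ← Real.sqrt_mul (by positivity)]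
    apply Real.abs_le_sqrt
    have h1 := hJ t x
    have h2 := hWnn x
    have h3 := hVnn t (x ᵥ* Zm (t + 1))
    rw [inv_mul_eq_div, le_div_iff₀ hv]
    linarith
  obtain ⟨m, hm0, hm⟩ : ∃ m : ℝ, 0 ≤ m ∧ ∀ x : Fin n → ℝ, |x ⬝ᵥ a1| ≤ m * S 1 x := by
    refine ⟨n * ‖a1‖ * (√w)⁻¹, by positivity, fun x => ?_⟩
    have h1 : √w * ‖x‖ ≤ S 1 x := by
      rw [hS]
      apply Real.le_sqrt_of_sq_le
      rw [mul_pow, Real.sq_sqrt hw.le]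
      exact (hWl x).trans (hV1 x)
    have hsw : 0 < √w := by positivity
    calc |x ⬝ᵥ a1| ≤ n * ‖x‖ * ‖a1‖ := dot_le_norm x a1
      _ = n * ‖a1‖ * (√w)⁻¹ * (√w * ‖x‖) := by field_simp
      _ ≤ _ := by gcongr
  have h1ρ : 0 < 1 - ρ := by linarith
  obtain ⟨β, hβ⟩ : ∃ β, β = B1 / (1 - ρ) := ⟨_, rfl⟩
  have hβ0 : 0 < β := by rw [hβ]; positivity
  have hβe : B1 + ρ * β = β := by rw [hβ]; field_simp; ring
  obtain ⟨α, hα⟩ : ∃ α, α = κ / (1 - ρ) + m / β := ⟨_, rfl⟩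
  have hα0 : 0 < α := by rw [hα]; positivity
  have hακ : κ + ρ * α ≤ α := by
    have : κ ≤ (1 - ρ) * α := by
      rw [hα, mul_add, mul_div_cancel₀ _ h1ρ.ne']
      have : 0 ≤ (1 - ρ) * (m / β) := by positivity
      linarith
    linarith
  have hαm : m ≤ α * β := by
    rw [hα, add_mul, div_mul_cancel₀ _ hβ0.ne']
    have : 0 ≤ κ / (1 - ρ) * β := by positivity
    linarith
  refine ⟨ρ, α * (ρ * (√r * ‖F‖)), β, hρ0, hρ1, by positivity, hβ0.le, ?_⟩
  intro Y hY _ a ha1 ha s t hs hst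
  have hstate : ∀ t, ∀ x, |x ⬝ᵥ a (t + 1)| ≤ α * (|Y (t + 1)| + β) * S (t + 1) x := by
    intro t
    induction t with
    | zero =>
      intro x
      rw [zero_add, ha1]
      refine (hm x).trans (mul_le_mul_of_nonneg_right (hαm.trans ?_) (hS0 _ _))
      have := abs_nonneg (Y 1)
      gcongr
      linarith
    | succ t ih =>
      intro x
      have h1 := ih (x ᵥ* Zm (t + 1))
      have h2 := hcontr (t + 1) (by omega) x
      have h3 := hgain (t + 1) (by omega) x
      have h4 : |Y (t + 1)| ≤ |Y (t + 1 + 1)| + B1 := by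
        have h5 := hY (t + 1)
        have h6 := abs_sub_abs_le_abs_sub (Y (t + 1)) (Y (t + 1 + 1))
        rw [abs_sub_comm] at h6
        linarith
      have h7 := hS0 (t + 1 + 1) x
      have hYn := abs_nonneg (Y (t + 1))
      rw [ha (t + 1) (by omega), dotProduct_add, dotProduct_smul, dotProduct_mulVec x (Zm (t + 1)),
        smul_eq_mul]
      calc _ ≤ |Y (t + 1)| * |x ⬝ᵥ (G *ᵥ Am (t + 1))| + |(x ᵥ* Zm (t + 1)) ⬝ᵥ a (t + 1)| := by
            rw [← abs_mul]; exact abs_add_le _ _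
        _ ≤ |Y (t + 1)| * (κ * S (t + 1 + 1) x)
            + α * (|Y (t + 1)| + β) * (ρ * S (t + 1 + 1) x) := by
            gcongr
            exact h1.trans (by gcongr)
        _ = ((κ + ρ * α) * |Y (t + 1)| + α * (ρ * β)) * S (t + 1 + 1) x := by ring
        _ ≤ (α * (|Y (t + 1 + 1)| + B1) + α * (ρ * β)) * S (t + 1 + 1) x := by gcongr
        _ = α * (|Y (t + 1 + 1)| + (B1 + ρ * β)) * S (t + 1 + 1) x := by ring
        _ = _ := by rw [hβe]
  have hprod : ∀ s, s < t →
      S (t - s) (F ᵥ* ((List.range (s + 1)).map fun i => Zm (t - i)).prod)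
        ≤ ρ ^ (s + 1) * S (t + 1) F := by
    intro s
    induction s with
    | zero =>
      intro h
      simpa using hcontr t (by omega) F
    | succ s ih =>
      intro h
      rw [List.range_succ, List.map_append, List.prod_append, ← vecMul_vecMul]
      simp only [List.map_cons, List.map_nil, List.prod_cons, List.prod_nil, mul_one]
      have h1 := hcontr (t - (s + 1)) (by omega)
        (F ᵥ* ((List.range (s + 1)).map fun i => Zm (t - i)).prod)
      have h2 : t - (s + 1) + 1 = t - s := by omega
      rw [h2] at h1
      have h3 := ih (by omega)
      calc _ ≤ _ := h1
        _ ≤ ρ * (ρ ^ (s + 1) * S (t + 1) F) := by gcongr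
        _ = _ := by ring
  have hYs : ∀ s, s ≤ t → |Y (t - s)| ≤ |Y t| + s * B1 := by
    intro s
    induction s with
    | zero => simp
    | succ s ih =>
      intro h
      have h1 := ih (by omega)
      have h5 := hY (t - (s + 1))
      have h2 : t - (s + 1) + 1 = t - s := by omega
      rw [h2, abs_sub_comm] at h5
      have h6 := abs_sub_abs_le_abs_sub (Y (t - (s + 1))) (Y (t - s))
      push_cast
      linarith
  have hSF : S (t + 1) F ≤ √r * ‖F‖ := by
    rw [hS]
    apply Real.sqrt_le_iff.2 ⟨by positivity, ?_⟩
    rw [mul_pow, Real.sq_sqrt hrpos.le]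
    exact hRu _ F
  have hts : t - s - 1 + 1 = t - s := by omega
  have h1 := hstate (t - s - 1) (F ᵥ* ((List.range (s + 1)).map fun i => Zm (t - i)).prod)
  rw [hts] at h1
  rw [dotProduct_mulVec]
  have h2 := hprod s hst
  have h3 := hYs s hst.le
  have h4 := abs_nonneg (Y (t - s))
  calc _ ≤ _ := h1
    _ ≤ α * (|Y (t - s)| + β) * (ρ ^ (s + 1) * (√r * ‖F‖)) := by
      gcongr
      exact h2.trans (by gcongr)
    _ ≤ α * (|Y t| + s * B1 + β) * (ρ ^ (s + 1) * (√r * ‖F‖)) := by gcongr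
    _ = _ := by ring
end

section
/- (LDS approximation, bounded case.) Consider the Kalman filter recursions for (G, F, v, W): n ≥ 1, G a real n×n matrix, F ∈ ℝⁿ, v > 0, W a symmetric positive definite n×n matrix; given a symmetric positive semidefinite initial covariance C_0, define for t ≥ 1: R_t = G C_{t−1} Gᵀ + W, Q_t = ⟨F, R_t F⟩ + v, A_t = R_t F/Q_t, C_t = R_t − Q_t A_t A_tᵀ, Z_t = G(I − A_t Fᵀ). Assume R_t converges (entrywise) as t → ∞ to a symmetric positive semidefinite matrix R satisfying the Riccati fixed-point equation R = G(R − (R F)(R F)ᵀ/(⟨F, R F⟩ + v))Gᵀ + W. Fix a_1 ∈ ℝⁿ. Then for every ε > 0 and every B_0 > 0, there exist T_0 ∈ ℕ, s ∈ ℕ with s ≥ 1, and θ ∈ ℝˢ such that: for every real sequence (Y_t)_{t≥0} with |Y_t| ≤ B_0 for all t, defining a_{t+1} = Y_t·G A_t + Z_t a_t for t ≥ 1 and the Kalman prediction f_{t+1} := ⟨F, a_{t+1}⟩, one has for every t ≥ T_0: |f_{t+1} − Σ_{i=0}^{s−1} θ_i·Y_{t−i}| ≤ ε. -/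
open Matrix Filter Topology BigOperators

lemma aux_unroll {E : Type*} [NormedAddCommGroup E] [NormedSpace ℝ E]
    (Z : E →L[ℝ] E) (a w : ℕ → E) (h : ∀ t, 1 ≤ t → a (t + 1) = Z (a t) + w t)
    (t s : ℕ) (hs : s ≤ t) :
    a (t + 1) = (Z ^ s) (a (t + 1 - s)) + ∑ i ∈ Finset.range s, (Z ^ i) (w (t - i)) := by
  induction s with
  | zero => simp
  | succ s ih =>
    rw [ih (by omega), Finset.sum_range_succ]
    have e1 : t + 1 - s = (t - s) + 1 := by omega
    have e2 : t + 1 - (s + 1) = t - s := by omega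
    rw [e1, e2, h (t - s) (by omega), map_add, pow_succ]
    rw [ContinuousLinearMap.mul_apply]
    abel

lemma aux_sum_bound {E : Type*} [NormedAddCommGroup E] [NormedSpace ℝ E]
    (Z : E →L[ℝ] E) (w : ℕ → E) (s : ℕ) (c : ℝ) (hw : ∀ i < s, ‖w i‖ ≤ c) :
    ‖∑ i ∈ Finset.range s, (Z ^ i) (w i)‖ ≤ (∑ i ∈ Finset.range s, ‖Z ^ i‖) * c := by
  rw [Finset.sum_mul]
  refine (norm_sum_le _ _).trans (Finset.sum_le_sum fun i hi => ?_)
  refine ((Z ^ i).le_opNorm _).trans ?_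
  exact mul_le_mul_of_nonneg_left (hw i (Finset.mem_range.mp hi)) (norm_nonneg _)

lemma aux_init {E : Type*} [NormedAddCommGroup E] [NormedSpace ℝ E]
    (Zt : ℕ → E →L[ℝ] E) (g : ℕ → E) (a1 : E) (B0 : ℝ) (T : ℕ) :
    ∃ K : ℝ, ∀ Y : ℕ → ℝ, (∀ t, |Y t| ≤ B0) → ∀ a : ℕ → E, a 1 = a1 →
      (∀ t, 1 ≤ t → a (t + 1) = Y t • g t + Zt t (a t)) →
      ∀ t, 1 ≤ t → t ≤ T + 1 → ‖a t‖ ≤ K := by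
  induction T with
  | zero =>
    refine ⟨‖a1‖, fun Y hY a ha hrec t h1 h2 => ?_⟩
    have : t = 1 := by omega
    rw [this, ha]
  | succ T ih =>
    obtain ⟨K, hK⟩ := ih
    refine ⟨max K (B0 * ‖g (T + 1)‖ + ‖Zt (T + 1)‖ * K), fun Y hY a ha hrec t h1 h2 => ?_⟩
    rcases Nat.lt_or_ge t (T + 2) with h | h
    · exact (hK Y hY a ha hrec t h1 (by omega)).trans (le_max_left _ _)
    · have : t = (T + 1) + 1 := by omega
      rw [this, hrec _ (by omega)]
      refine le_trans ?_ (le_max_right _ _)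
      refine (norm_add_le _ _).trans (add_le_add ?_ ?_)
      · rw [norm_smul, Real.norm_eq_abs]
        exact mul_le_mul_of_nonneg_right (hY _) (norm_nonneg _)
      · refine ((Zt (T + 1)).le_opNorm _).trans ?_
        exact mul_le_mul_of_nonneg_left (hK Y hY a ha hrec _ (by omega) (by omega))
          (norm_nonneg _)

lemma aux_main {E : Type*} [NormedAddCommGroup E] [NormedSpace ℝ E]
    (Z : E →L[ℝ] E) (Zt : ℕ → E →L[ℝ] E) (g : ℕ → E) (g0 a1 : E) (φ : E →L[ℝ] ℝ)
    (hZt : Tendsto Zt atTop (𝓝 Z)) (hg : Tendsto g atTop (𝓝 g0))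
    (hpow : Tendsto (fun k => Z ^ k) atTop (𝓝 0))
    (ε B0 : ℝ) (hε : 0 < ε) (hB0 : 0 < B0) :
    ∃ (T0 s : ℕ), 1 ≤ s ∧ ∃ θ : Fin s → ℝ,
      ∀ Y : ℕ → ℝ, (∀ t, |Y t| ≤ B0) →
      ∀ a : ℕ → E, a 1 = a1 →
        (∀ t, 1 ≤ t → a (t + 1) = Y t • g t + Zt t (a t)) →
      ∀ t : ℕ, T0 ≤ t →
        |φ (a (t + 1)) - ∑ i : Fin s, θ i * Y (t - (i : ℕ))| ≤ ε := by
  have hpow' : Tendsto (fun k => ‖Z ^ k‖) atTop (𝓝 0) := by simpa using hpow.norm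
  have hZn : Tendsto (fun t => ‖Zt t - Z‖) atTop (𝓝 0) := by
    simpa using (hZt.sub_const Z).norm
  have hgn : Tendsto (fun t => ‖g t - g0‖) atTop (𝓝 0) := by
    simpa using (hg.sub_const g0).norm
  -- uniform bound on the states
  obtain ⟨M, hM0, hM⟩ : ∃ M : ℝ, 0 ≤ M ∧ ∀ Y : ℕ → ℝ, (∀ t, |Y t| ≤ B0) →
      ∀ a : ℕ → E, a 1 = a1 →
      (∀ t, 1 ≤ t → a (t + 1) = Y t • g t + Zt t (a t)) → ∀ t, 1 ≤ t → ‖a t‖ ≤ M := by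
    obtain ⟨s, hs, hs1⟩ := ((hpow'.eventually_le_const (show (0 : ℝ) < 1 / 4 by norm_num)).and
      (eventually_ge_atTop 1)).exists
    set K := ∑ i ∈ Finset.range s, ‖Z ^ i‖ with hKdef
    have hK0 : 0 ≤ K := Finset.sum_nonneg fun _ _ => norm_nonneg _
    obtain ⟨Cg, hCg⟩ : ∃ Cg : ℝ, ∀ t, ‖g t‖ ≤ Cg := by
      obtain ⟨C, hC⟩ := hg.norm.bddAbove_range
      exact ⟨C, fun t => hC ⟨t, rfl⟩⟩
    have hKZ : Tendsto (fun t => K * ‖Zt t - Z‖) atTop (𝓝 0) := by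
      simpa using hZn.const_mul K
    obtain ⟨T1, hT1⟩ := eventually_atTop.mp
      (hKZ.eventually_le_const (show (0 : ℝ) < 1 / 4 by norm_num))
    have hT1' : ∃ η : ℝ, 0 ≤ η ∧ K * η ≤ 1 / 4 ∧ ∀ t ≥ T1, ‖Zt t - Z‖ ≤ η := by
      rcases hK0.eq_or_lt with h | h
      · obtain ⟨C, hC⟩ := hZn.bddAbove_range
        exact ⟨C, (norm_nonneg _).trans (hC ⟨0, rfl⟩), by rw [← h]; norm_num,
          fun t _ => hC ⟨t, rfl⟩⟩
      · refine ⟨1 / 4 / K, by positivity, by field_simp; norm_num, fun t ht => ?_⟩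
        rw [le_div_iff₀ h, mul_comm]
        exact hT1 t ht
    obtain ⟨η, hη0, hη, hη'⟩ := hT1'
    obtain ⟨K0, hK0'⟩ := aux_init Zt g a1 B0 (T1 + s)
    refine ⟨max 0 (max K0 (2 * (K * (B0 * Cg)))), le_max_left _ _, ?_⟩
    set M := max 0 (max K0 (2 * (K * (B0 * Cg)))) with hMdef
    have hM0 : 0 ≤ M := le_max_left _ _
    have hM1 : K0 ≤ M := (le_max_left _ _).trans (le_max_right _ _)
    have hM2 : 2 * (K * (B0 * Cg)) ≤ M := (le_max_right _ _).trans (le_max_right _ _)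
    intro Y hY a ha hrec t
    induction t using Nat.strong_induction_on with
    | _ t ih =>
      intro ht1
      rcases Nat.lt_or_ge (T1 + s + 1) t with h | h
      · obtain ⟨u, rfl⟩ : ∃ u, t = u + 1 := ⟨t - 1, by omega⟩
        rw [aux_unroll Z a (fun t => Y t • g t + (Zt t - Z) (a t)) (fun t ht => by
          rw [hrec t ht]; simp; abel) u s (by omega)]
        have b1 : ‖(Z ^ s) (a (u + 1 - s))‖ ≤ 1 / 4 * M :=
          ((Z ^ s).le_opNorm _).trans (mul_le_mul hs (ih _ (by omega) (by omega))
            (norm_nonneg _) (by norm_num))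
        have b2 := aux_sum_bound Z (fun i => Y (u - i) • g (u - i) +
          (Zt (u - i) - Z) (a (u - i))) s (B0 * Cg + η * M) (fun i hi => by
            refine (norm_add_le _ _).trans (add_le_add ?_ ?_)
            · rw [norm_smul, Real.norm_eq_abs]
              exact mul_le_mul (hY _) (hCg _) (norm_nonneg _) hB0.le
            · exact ((Zt (u - i) - Z).le_opNorm _).trans
                (mul_le_mul (hη' _ (by omega)) (ih _ (by omega) (by omega))
                (norm_nonneg _) hη0))
        refine (norm_add_le _ _).trans ?_
        have : K * η * M ≤ 1 / 4 * M := mul_le_mul_of_nonneg_right hη hM0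
        rw [← hKdef] at b2
        nlinarith
      · exact (hK0' Y hY a ha hrec t ht1 (by omega)).trans hM1
  have hφ : Tendsto (fun k => ‖φ‖ * (‖Z ^ k‖ * M)) atTop (𝓝 0) := by
    simpa using (hpow'.mul_const M).const_mul ‖φ‖
  obtain ⟨s, hs, hs1⟩ := ((hφ.eventually_le_const (half_pos hε)).and
    (eventually_ge_atTop 1)).exists
  set K := ∑ i ∈ Finset.range s, ‖Z ^ i‖ with hKdef
  have hK0 : 0 ≤ K := Finset.sum_nonneg fun _ _ => norm_nonneg _
  have hp : Tendsto (fun t => B0 * ‖g t - g0‖ + ‖Zt t - Z‖ * M) atTop (𝓝 0) := by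
    simpa using (hgn.const_mul B0).add (hZn.mul_const M)
  have hD : 0 < ‖φ‖ * K + 1 := by positivity
  obtain ⟨T2, hT2⟩ := eventually_atTop.mp
    (hp.eventually_le_const (show 0 < ε / 2 / (‖φ‖ * K + 1) by positivity))
  set δ := ε / 2 / (‖φ‖ * K + 1) with hδ
  have hδ1 : ‖φ‖ * (K * δ) ≤ ε / 2 := by
    have : (‖φ‖ * K + 1) * δ = ε / 2 := by rw [hδ]; field_simp
    have h0 : 0 < δ := by positivity
    nlinarith
  refine ⟨T2 + s + 1, s, hs1, fun i => φ ((Z ^ (i : ℕ)) g0), ?_⟩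
  intro Y hY a ha hrec t ht
  have hb := hM Y hY a ha hrec
  rw [Fin.sum_univ_eq_sum_range (fun i => φ ((Z ^ i) g0) * Y (t - i)) s]
  rw [aux_unroll Z a (fun t => Y t • g0 + (Y t • (g t - g0) + (Zt t - Z) (a t))) (fun t ht => by
          rw [hrec t ht, smul_sub]; simp; abel) t s (by omega)]
  have e : φ ((Z ^ s) (a (t + 1 - s)) + ∑ i ∈ Finset.range s, (Z ^ i)
      (Y (t - i) • g0 + (Y (t - i) • (g (t - i) - g0) + (Zt (t - i) - Z) (a (t - i)))))
      - ∑ i ∈ Finset.range s, φ ((Z ^ i) g0) * Y (t - i)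
      = φ ((Z ^ s) (a (t + 1 - s))) + φ (∑ i ∈ Finset.range s, (Z ^ i)
      (Y (t - i) • (g (t - i) - g0) + (Zt (t - i) - Z) (a (t - i)))) := by
    have : ∀ i, (Z ^ i)
      (Y (t - i) • g0 + (Y (t - i) • (g (t - i) - g0) + (Zt (t - i) - Z) (a (t - i))))
      = Y (t - i) • (Z ^ i) g0 + (Z ^ i)
        (Y (t - i) • (g (t - i) - g0) + (Zt (t - i) - Z) (a (t - i))) := by
      intro i
      rw [map_add, map_smul]
    simp_rw [this]
    rw [Finset.sum_add_distrib, map_add, map_add, map_sum φ (fun i => Y (t - i) • (Z ^ i) g0)]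
    simp only [map_smul, smul_eq_mul, mul_comm (Y _)]
    ring
  rw [e]
  have b1 : |φ ((Z ^ s) (a (t + 1 - s)))| ≤ ε / 2 := by
    refine (φ.le_opNorm _).trans (le_trans ?_ hs)
    refine mul_le_mul_of_nonneg_left ?_ (norm_nonneg _)
    exact ((Z ^ s).le_opNorm _).trans
      (mul_le_mul_of_nonneg_left (hb _ (by omega)) (norm_nonneg _))
  have b2 := aux_sum_bound Z (fun i => Y (t - i) • (g (t - i) - g0) +
      (Zt (t - i) - Z) (a (t - i))) s δ (fun i hi => by
        refine le_trans ?_ (hT2 (t - i) (by omega))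
        refine (norm_add_le _ _).trans (add_le_add ?_ ?_)
        · rw [norm_smul, Real.norm_eq_abs]
          exact mul_le_mul_of_nonneg_right (hY _) (norm_nonneg _)
        · exact ((Zt (t - i) - Z).le_opNorm _).trans
            (mul_le_mul_of_nonneg_left (hb _ (by omega)) (norm_nonneg _)))
  have b3 := (φ.le_opNorm _).trans (mul_le_mul_of_nonneg_left b2 (norm_nonneg φ))
  rw [Real.norm_eq_abs] at b3
  refine (abs_add_le _ _).trans ?_
  linarith

open scoped MatrixOrder in
/-- Lyapunov: if `x·Wx + (Tx)·R(Tx) ≤ x·Rx` with `W` positive definite, `R ≥ 0`, then `T^k x → 0`. -/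
lemma aux_lyap {n : ℕ} (T W R : Matrix (Fin n) (Fin n) ℝ) (hW : W.PosDef) (hR : R.PosSemidef)
    (h : ∀ x : Fin n → ℝ, x ⬝ᵥ (W *ᵥ x) + (T *ᵥ x) ⬝ᵥ (R *ᵥ (T *ᵥ x)) ≤ x ⬝ᵥ (R *ᵥ x)) :
    Tendsto (fun k => T ^ k) atTop (𝓝 0) := by
  have hR0 : ∀ x : Fin n → ℝ, 0 ≤ x ⬝ᵥ (R *ᵥ x) := fun x => by
    simpa using hR.dotProduct_mulVec_nonneg x
  have hW0 : ∀ x : Fin n → ℝ, 0 ≤ x ⬝ᵥ (W *ᵥ x) := fun x => by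
    simpa using hW.posSemidef.dotProduct_mulVec_nonneg x
  obtain ⟨B, hB, hWB⟩ : ∃ B : Matrix (Fin n) (Fin n) ℝ, IsUnit B ∧ W = Bᵀ * B := by
    obtain ⟨B, hB⟩ := CStarAlgebra.nonneg_iff_eq_star_mul_self.mp
      (Matrix.nonneg_iff_posSemidef.mpr hW.posSemidef)
    rw [star_eq_conjTranspose, conjTranspose_eq_transpose_of_trivial] at hB
    refine ⟨B, ?_, hB⟩
    have hu := (Matrix.isUnit_iff_isUnit_det W).mp hW.isUnit
    rw [hB, det_mul] at hu
    exact (Matrix.isUnit_iff_isUnit_det B).mpr (isUnit_of_mul_isUnit_right hu)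
  have key : ∀ x : Fin n → ℝ, Tendsto (fun k => (T ^ k) *ᵥ x) atTop (𝓝 0) := by
    intro x
    have hsum : ∀ N, ∑ k ∈ Finset.range N, ((T ^ k) *ᵥ x) ⬝ᵥ (W *ᵥ ((T ^ k) *ᵥ x))
        ≤ x ⬝ᵥ (R *ᵥ x) - ((T ^ N) *ᵥ x) ⬝ᵥ (R *ᵥ ((T ^ N) *ᵥ x)) := by
      intro N
      induction N with
      | zero => simp
      | succ N ih =>
        rw [Finset.sum_range_succ]
        have := h ((T ^ N) *ᵥ x)
        rw [mulVec_mulVec (M := T), ← pow_succ'] at this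
        linarith
    have hs : Summable fun k => ((T ^ k) *ᵥ x) ⬝ᵥ (W *ᵥ ((T ^ k) *ᵥ x)) :=
      summable_of_sum_range_le (fun k => hW0 _)
        (fun N => (hsum N).trans (sub_le_self _ (hR0 _)))
    have h0 := hs.tendsto_atTop_zero
    have hBx : Tendsto (fun k => B *ᵥ ((T ^ k) *ᵥ x)) atTop (𝓝 0) := by
      rw [tendsto_pi_nhds]
      intro i
      have e : ∀ y : Fin n → ℝ, y ⬝ᵥ (W *ᵥ y) = ∑ i, (B *ᵥ y) i ^ 2 := by
        intro y
        rw [hWB, ← mulVec_mulVec, dotProduct_mulVec, vecMul_transpose]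
        simp [dotProduct, sq]
      simp_rw [e] at h0
      have h1 : Tendsto (fun k => (B *ᵥ ((T ^ k) *ᵥ x)) i ^ 2) atTop (𝓝 0) :=
        squeeze_zero (fun k => sq_nonneg _) (fun k => Finset.single_le_sum
          (f := fun i => (B *ᵥ ((T ^ k) *ᵥ x)) i ^ 2)
          (fun j _ => sq_nonneg _) (Finset.mem_univ i)) h0
      have h2 := h1.sqrt
      simp only [Real.sqrt_sq_eq_abs, Real.sqrt_zero] at h2
      exact (tendsto_zero_iff_abs_tendsto_zero _).mpr h2
    have hc : Continuous fun y : Fin n → ℝ => B⁻¹ *ᵥ y := by fun_prop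
    have := (hc.tendsto 0).comp hBx
    simpa [Function.comp_def, mulVec_mulVec, ← Matrix.mul_assoc,
      Matrix.nonsing_inv_mul B ((Matrix.isUnit_iff_isUnit_det B).mp hB)] using this
  refine tendsto_pi_nhds.mpr fun i => tendsto_pi_nhds.mpr fun j => ?_
  have := tendsto_pi_nhds.mp (key (Pi.single j 1)) i
  simpa using this

/-- LDS approximation, bounded case: For the Kalman filter recursions
`R_t = G C_{t−1} Gᵀ + W`, `Q_t = ⟨F, R_t F⟩ + v`, `A_t = R_t F/Q_t`,
`C_t = R_t − Q_t A_t A_tᵀ`, `Z_t = G(I − A_t Fᵀ)` (for `t ≥ 1`, with `C_0` a symmetric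
positive semidefinite initial covariance), `W` symmetric positive definite, `v > 0`,
assuming `R_t → R` entrywise with `R` a symmetric positive semidefinite solution of the
Riccati fixed-point equation: for any fixed `a_1`, every `ε > 0` and `B_0 > 0`, there
exist `T_0`, `s ≥ 1` and `θ ∈ ℝˢ` such that for every sequence `Y` with `|Y_t| ≤ B_0`,
with `a_{t+1} = Y_t·G A_t + Z_t a_t` for `t ≥ 1` and Kalman prediction
`f_{t+1} := ⟨F, a_{t+1}⟩`, one has `|f_{t+1} − Σ_{i<s} θ_i·Y_{t−i}| ≤ ε` for all
`t ≥ T_0`. -/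
theorem stmt_11 {n : ℕ} (hn : 1 ≤ n) (G W C0 : Matrix (Fin n) (Fin n) ℝ)
    (F a1 : Fin n → ℝ) (v : ℝ) (hv : 0 < v) (hW : W.PosDef) (hC0 : C0.PosSemidef)
    (Rm Cm : ℕ → Matrix (Fin n) (Fin n) ℝ) (Qm : ℕ → ℝ)
    (Am : ℕ → Fin n → ℝ) (Zm : ℕ → Matrix (Fin n) (Fin n) ℝ)
    (hCm0 : Cm 0 = C0)
    (hRm : ∀ t, Rm (t + 1) = G * Cm t * Gᵀ + W)
    (hQm : ∀ t, Qm (t + 1) = F ⬝ᵥ (Rm (t + 1) *ᵥ F) + v)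
    (hAm : ∀ t, Am (t + 1) = (Qm (t + 1))⁻¹ • (Rm (t + 1) *ᵥ F))
    (hCm : ∀ t, Cm (t + 1) =
      Rm (t + 1) - Qm (t + 1) • vecMulVec (Am (t + 1)) (Am (t + 1)))
    (hZm : ∀ t, Zm (t + 1) = G * (1 - vecMulVec (Am (t + 1)) F))
    (R : Matrix (Fin n) (Fin n) ℝ)
    (hconv : ∀ i j, Tendsto (fun t => Rm t i j) atTop (nhds (R i j)))
    (hR : R.PosSemidef)
    (hRic : R = G * (R - (F ⬝ᵥ (R *ᵥ F) + v)⁻¹ • vecMulVec (R *ᵥ F) (R *ᵥ F)) * Gᵀ + W)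
    (ε B0 : ℝ) (hε : 0 < ε) (hB0 : 0 < B0) :
    ∃ (T0 s : ℕ), 1 ≤ s ∧ ∃ θ : Fin s → ℝ,
      ∀ Y : ℕ → ℝ, (∀ t, |Y t| ≤ B0) →
      ∀ a : ℕ → Fin n → ℝ, a 1 = a1 →
        (∀ t, 1 ≤ t → a (t + 1) = Y t • (G *ᵥ Am t) + Zm t *ᵥ a t) →
      ∀ t : ℕ, T0 ≤ t →
        |F ⬝ᵥ a (t + 1) - ∑ i : Fin s, θ i * Y (t - (i : ℕ))| ≤ ε := by
  have hmat : ∀ {M : ℕ → Matrix (Fin n) (Fin n) ℝ} {L : Matrix (Fin n) (Fin n) ℝ},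
      (∀ i j, Tendsto (fun t => M t i j) atTop (𝓝 (L i j))) → Tendsto M atTop (𝓝 L) :=
    fun h => tendsto_pi_nhds.mpr fun i => tendsto_pi_nhds.mpr fun j => h i j
  have hRt : Tendsto Rm atTop (𝓝 R) := hmat hconv
  set Q := F ⬝ᵥ (R *ᵥ F) + v with hQ
  have hQ0 : 0 < Q := by
    have : 0 ≤ F ⬝ᵥ (R *ᵥ F) := by simpa using hR.dotProduct_mulVec_nonneg F
    linarith
  set A := Q⁻¹ • (R *ᵥ F) with hA
  set Z := G * (1 - vecMulVec A F) with hZ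
  have hRF : Tendsto (fun t => Rm t *ᵥ F) atTop (𝓝 (R *ᵥ F)) := by
    have hc : Continuous fun M : Matrix (Fin n) (Fin n) ℝ => M *ᵥ F := by fun_prop
    exact (hc.tendsto R).comp hRt
  have hQt : Tendsto (fun t => F ⬝ᵥ (Rm t *ᵥ F) + v) atTop (𝓝 Q) := by
    have hc : Continuous fun y : Fin n → ℝ => F ⬝ᵥ y + v := by fun_prop
    exact (hc.tendsto _).comp hRF
  have hAt : Tendsto Am atTop (𝓝 A) := by
    refine Tendsto.congr' ?_ ((hQt.inv₀ hQ0.ne').smul hRF)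
    filter_upwards [eventually_ge_atTop 1] with t ht
    obtain ⟨u, rfl⟩ : ∃ u, t = u + 1 := ⟨t - 1, by omega⟩
    rw [hAm, hQm]
  have hZt : Tendsto Zm atTop (𝓝 Z) := by
    have hc : Continuous fun y : Fin n → ℝ => G * (1 - vecMulVec y F) := by fun_prop
    refine Tendsto.congr' ?_ ((hc.tendsto A).comp hAt)
    filter_upwards [eventually_ge_atTop 1] with t ht
    obtain ⟨u, rfl⟩ : ∃ u, t = u + 1 := ⟨t - 1, by omega⟩
    simp [hZm]
  have hgt : Tendsto (fun t => G *ᵥ Am t) atTop (𝓝 (G *ᵥ A)) := by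
    have hc : Continuous fun y : Fin n → ℝ => G *ᵥ y := by fun_prop
    exact (hc.tendsto A).comp hAt
  have hRs : Rᵀ = R := by simpa using hR.isHermitian.eq
  -- Lyapunov inequality
  have hlyap : ∀ x : Fin n → ℝ, x ⬝ᵥ (W *ᵥ x) + (Zᵀ *ᵥ x) ⬝ᵥ (R *ᵥ (Zᵀ *ᵥ x))
      ≤ x ⬝ᵥ (R *ᵥ x) := by
    intro x
    set y := Gᵀ *ᵥ x with hy
    have e1 : x ⬝ᵥ (R *ᵥ x) = y ⬝ᵥ (R *ᵥ y) - Q⁻¹ * (y ⬝ᵥ (R *ᵥ F)) ^ 2 + x ⬝ᵥ (W *ᵥ x) := by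
      conv_lhs => rw [hRic]
      rw [add_mulVec, dotProduct_add, ← mulVec_mulVec, ← mulVec_mulVec, dotProduct_mulVec x G,
        ← mulVec_transpose, ← hy, sub_mulVec, smul_mulVec, vecMulVec_mulVec, dotProduct_sub,
        dotProduct_smul]
      simp only [op_smul_eq_smul, dotProduct_smul, smul_eq_mul]
      rw [dotProduct_comm (R *ᵥ F) y]
      ring
    have e2 : Zᵀ *ᵥ x = y - (A ⬝ᵥ y) • F := by
      rw [hZ, transpose_mul, ← mulVec_mulVec, ← hy, transpose_sub, transpose_one,
        transpose_vecMulVec, sub_mulVec, one_mulVec, vecMulVec_mulVec]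
      simp
    have e3 : F ⬝ᵥ (R *ᵥ y) = y ⬝ᵥ (R *ᵥ F) := by
      rw [dotProduct_mulVec, ← mulVec_transpose, hRs, dotProduct_comm]
    have e4 : A ⬝ᵥ y = Q⁻¹ * (y ⬝ᵥ (R *ᵥ F)) := by
      rw [hA, smul_dotProduct, dotProduct_comm, smul_eq_mul]
    have e5 : F ⬝ᵥ (R *ᵥ F) = Q - v := by rw [hQ]; ring
    rw [e1, e2, e4, mulVec_sub, sub_dotProduct, dotProduct_sub, dotProduct_sub, mulVec_smul]
    simp only [dotProduct_smul, smul_dotProduct, smul_eq_mul]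
    rw [e3, e5]
    set r := y ⬝ᵥ (R *ᵥ F)
    have : Q⁻¹ * Q = 1 := inv_mul_cancel₀ hQ0.ne'
    have e6 : Q⁻¹ * r * (Q⁻¹ * r * (Q - v)) = Q⁻¹ * r ^ 2 - v * (Q⁻¹ * r) ^ 2 := by
      linear_combination (Q⁻¹ * r ^ 2) * this
    have : 0 ≤ v * (Q⁻¹ * r) ^ 2 := by positivity
    nlinarith
  have hTpow := aux_lyap Zᵀ W R hW hR hlyap
  have hZpow : Tendsto (fun k => Z ^ k) atTop (𝓝 0) := by
    refine hmat fun i j => ?_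
    have := tendsto_pi_nhds.mp (tendsto_pi_nhds.mp hTpow j) i
    simpa [← transpose_pow] using this
  -- pass to continuous linear maps
  let Φ : Matrix (Fin n) (Fin n) ℝ ≃ₐ[ℝ] ((Fin n → ℝ) →L[ℝ] (Fin n → ℝ)) :=
    Matrix.toLinAlgEquiv'.trans (Module.End.toContinuousLinearMap (Fin n → ℝ))
  have hΦ : ∀ M x, Φ M x = M *ᵥ x := fun M x => rfl
  have hΦc : Continuous Φ := Φ.toLinearMap.continuous_of_finiteDimensional
  let φ : (Fin n → ℝ) →L[ℝ] ℝ := LinearMap.toContinuousLinearMap (dotProductBilin ℝ ℝ F)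
  have hφ : ∀ x, φ x = F ⬝ᵥ x := fun x => rfl
  have hfin := aux_main (Φ Z) (fun t => Φ (Zm t)) (fun t => G *ᵥ Am t) (G *ᵥ A) a1 φ
    ((hΦc.tendsto Z).comp hZt) hgt (by
      have := (hΦc.tendsto 0).comp hZpow
      simpa [Function.comp_def] using this) ε B0 hε hB0
  exact hfin
end

section
/- (LDS approximation, Lipschitz case.) Consider the Kalman filter recursions for (G, F, v, W): n ≥ 1, G a real n×n matrix, F ∈ ℝⁿ, v > 0, W a symmetric positive definite n×n matrix; given a symmetric positive semidefinite initial covariance C_0, define for t ≥ 1: R_t = G C_{t−1} Gᵀ + W, Q_t = ⟨F, R_t F⟩ + v, A_t = R_t F/Q_t, C_t = R_t − Q_t A_t A_tᵀ, Z_t = G(I − A_t Fᵀ). Assume R_t converges (entrywise) as t → ∞ to a symmetric positive semidefinite matrix R satisfying the Riccati fixed-point equation R = G(R − (R F)(R F)ᵀ/(⟨F, R F⟩ + v))Gᵀ + W. Fix a_1 ∈ ℝⁿ. Then for every ε > 0, δ > 0, and B_1 > 0, there exist T_0 ∈ ℕ, s ∈ ℕ with s ≥ 1, and θ ∈ ℝˢ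 such that: for every real sequence (Y_t)_{t≥0} with |Y_{t+1} − Y_t| ≤ B_1 for all t ≥ 0 and |Y_0| ≤ B_1, defining a_{t+1} = Y_t·G A_t + Z_t a_t for t ≥ 1 and f_{t+1} := ⟨F, a_{t+1}⟩, one has for every t ≥ T_0: |f_{t+1} − Σ_{i=0}^{s−1} θ_i·Y_{t−i}| ≤ 2·max(ε, δ·|Y_t|). -/
open Matrix Filter Topology BigOperators

theorem abs_lemma {E : Type*} [NormedAddCommGroup E] [NormedSpace ℝ E]
    (Zt : ℕ → E →L[ℝ] E) (Z : E →L[ℝ] E) (hZ : Tendsto Zt atTop (𝓝 Z))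
    (gt : ℕ → E) (g : E) (hg : Tendsto gt atTop (𝓝 g)) (hZ1 : ‖Z‖ < 1)
    (φ : E →L[ℝ] ℝ) (a1 : E) (ε δ B1 : ℝ) (hε : 0 < ε) (hδ : 0 < δ) (hB1 : 0 < B1) :
    ∃ (T0 s : ℕ), 1 ≤ s ∧ ∃ θ : Fin s → ℝ,
      ∀ Y : ℕ → ℝ, (∀ t, |Y (t + 1) - Y t| ≤ B1) → |Y 0| ≤ B1 →
      ∀ a : ℕ → E, a 1 = a1 →
        (∀ t, 1 ≤ t → a (t + 1) = Y t • gt t + Zt t (a t)) →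
      ∀ t : ℕ, T0 ≤ t →
        |φ (a (t + 1)) - ∑ i : Fin s, θ i * Y (t - (i : ℕ))|
          ≤ 2 * max ε (δ * |Y t|) := by
  obtain ⟨ρ, hρZ, hρ1⟩ := exists_between hZ1
  have hρ0 : 0 < ρ := (norm_nonneg Z).trans_lt hρZ
  obtain ⟨r, hρr, hr1⟩ := exists_between hρ1
  have hr0 : 0 < r := hρ0.trans hρr
  have h1r : 0 < 1 - r := by linarith
  obtain ⟨D, hD⟩ : ∃ D, D = ρ * B1 / (r - ρ) := ⟨_, rfl⟩
  have hrρ : 0 < r - ρ := by linarith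
  have hD0 : 0 < D := by rw [hD]; positivity
  have hDeq : ρ * (B1 + D) = r * D := by rw [hD]; field_simp; ring
  have hstep : ∀ Y : ℕ → ℝ, (∀ t, |Y (t + 1) - Y t| ≤ B1) → ∀ t,
      ρ * (|Y t| + D) ≤ r * (|Y (t+1)| + D) := by
    intro Y hY t
    have h1 : |Y t| ≤ |Y (t+1)| + B1 := by
      have := abs_sub_abs_le_abs_sub (Y t) (Y (t+1))
      rw [abs_sub_comm] at this
      linarith [hY t]
    have h2 : ρ * |Y (t+1)| ≤ r * |Y (t+1)| :=
      mul_le_mul_of_nonneg_right hρr.le (abs_nonneg _)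
    nlinarith
  have hYb : ∀ Y : ℕ → ℝ, (∀ t, |Y (t + 1) - Y t| ≤ B1) → |Y 0| ≤ B1 → ∀ t : ℕ,
      |Y t| ≤ (t + 1) * B1 := by
    intro Y hY h0 t
    induction t with
    | zero => simpa using h0
    | succ t ih =>
      have := abs_sub_abs_le_abs_sub (Y (t+1)) (Y t)
      push_cast
      linarith [hY t]
  have hfin : ∀ t : ℕ, ∃ K : ℝ, ∀ Y : ℕ → ℝ, (∀ t, |Y (t + 1) - Y t| ≤ B1) → |Y 0| ≤ B1 →
      ∀ a : ℕ → E, a 1 = a1 →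
        (∀ t, 1 ≤ t → a (t + 1) = Y t • gt t + Zt t (a t)) → ‖a (t+1)‖ ≤ K := by
    intro t
    induction t with
    | zero => exact ⟨‖a1‖, fun Y _ _ a h _ => by simp [h]⟩
    | succ t ih =>
      obtain ⟨K, hK⟩ := ih
      refine ⟨(((t+1 : ℕ) : ℝ) + 1) * B1 * ‖gt (t+1)‖ + ‖Zt (t+1)‖ * K, ?_⟩
      intro Y hY h0 a ha hrec
      have h1 := hK Y hY h0 a ha hrec
      rw [hrec (t+1) (by omega)]
      refine (norm_add_le _ _).trans (add_le_add ?_ ?_)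
      · rw [norm_smul, Real.norm_eq_abs]
        exact mul_le_mul_of_nonneg_right (hYb Y hY h0 _) (norm_nonneg _)
      · exact (ContinuousLinearMap.le_opNorm _ _).trans
          (mul_le_mul_of_nonneg_left h1 (norm_nonneg _))
  have hev1 : ∀ᶠ t in atTop, ‖Zt t‖ ≤ ρ ∧ ‖gt t‖ ≤ ‖g‖ + 1 :=
    ((hZ.norm.eventually (ge_mem_nhds hρZ)).and (hg.norm.eventually (ge_mem_nhds (by linarith))))
  obtain ⟨T1, hT1⟩ := eventually_atTop.1 hev1
  obtain ⟨K1, hK1⟩ := hfin T1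
  obtain ⟨K, hKdef⟩ : ∃ K, K = max (K1 / D) ((‖g‖ + 1) / (1 - r)) := ⟨_, rfl⟩
  have hKa : K1 ≤ K * D := by
    rw [← div_le_iff₀ hD0, hKdef]; exact le_max_left _ _
  have hKb : ‖g‖ + 1 ≤ K * (1 - r) := by
    rw [← div_le_iff₀ h1r, hKdef]; exact le_max_right _ _
  have hK0 : 0 < K := by
    by_contra h
    push Not at h
    nlinarith [norm_nonneg g]
  have hbd : ∀ Y : ℕ → ℝ, (∀ t, |Y (t + 1) - Y t| ≤ B1) → |Y 0| ≤ B1 →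
      ∀ a : ℕ → E, a 1 = a1 →
        (∀ t, 1 ≤ t → a (t + 1) = Y t • gt t + Zt t (a t)) →
      ∀ t, T1 ≤ t → ‖a (t+1)‖ ≤ K * (|Y t| + D) := by
    intro Y hY h0 a ha hrec t ht
    induction t, ht using Nat.le_induction with
    | base =>
      have := hK1 Y hY h0 a ha hrec
      nlinarith [mul_nonneg hK0.le (abs_nonneg (Y T1))]
    | succ t ht ih =>
      rw [hrec (t+1) (by omega)]
      obtain ⟨hz, hgg⟩ := hT1 (t+1) (by omega)
      have e1 : ‖Y (t+1) • gt (t+1)‖ ≤ (|Y (t+1)| + D) * (K * (1 - r)) := by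
        rw [norm_smul, Real.norm_eq_abs]
        exact mul_le_mul (by linarith) (hgg.trans hKb) (norm_nonneg _) (by positivity)
      have e2 : ‖Zt (t+1) (a (t+1))‖ ≤ K * (r * (|Y (t+1)| + D)) :=
        calc _ ≤ ‖Zt (t+1)‖ * ‖a (t+1)‖ := ContinuousLinearMap.le_opNorm _ _
          _ ≤ ρ * (K * (|Y t| + D)) := mul_le_mul hz ih (norm_nonneg _) hρ0.le
          _ = K * (ρ * (|Y t| + D)) := by ring
          _ ≤ _ := mul_le_mul_of_nonneg_left (hstep Y hY t) hK0.le
      refine (norm_add_le _ _).trans ?_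
      linarith
  obtain ⟨κ, hκ⟩ : ∃ κ, κ = min δ (ε / D) / (‖φ‖ + 1) := ⟨_, rfl⟩
  have hφ1 : 0 < ‖φ‖ + 1 := by positivity
  have hκ0 : 0 < κ := by rw [hκ]; have := lt_min hδ (div_pos hε hD0); positivity
  have hκφ : ‖φ‖ * κ ≤ min δ (ε / D) := by
    have : (‖φ‖ + 1) * κ = min δ (ε / D) := by rw [hκ]; field_simp
    nlinarith
  obtain ⟨H, hH⟩ : ∃ H, H = 1 + K * r / ρ := ⟨_, rfl⟩
  have hH0 : 0 < H := by rw [hH]; positivity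
  obtain ⟨η, hη⟩ : ∃ η, η = κ * (1 - r) / (2 * H) := ⟨_, rfl⟩
  have hη0 : 0 < η := by rw [hη]; positivity
  have hηH : H * η = (κ / 2) * (1 - r) := by rw [hη]; field_simp
  have hev2 : ∀ᶠ t in atTop, ‖Zt t - Z‖ ≤ η ∧ ‖gt t - g‖ ≤ η := by
    have h1 : Tendsto (fun t => ‖Zt t - Z‖) atTop (𝓝 0) := tendsto_iff_norm_sub_tendsto_zero.1 hZ
    have h2 : Tendsto (fun t => ‖gt t - g‖) atTop (𝓝 0) := tendsto_iff_norm_sub_tendsto_zero.1 hg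
    exact (h1.eventually (ge_mem_nhds hη0)).and (h2.eventually (ge_mem_nhds hη0))
  obtain ⟨T2, hT2⟩ := eventually_atTop.1 hev2
  obtain ⟨s0, hs0⟩ := exists_pow_lt_of_lt_one (show 0 < κ / 2 / K by positivity) hr1
  obtain ⟨s, hs⟩ : ∃ s, s = s0 + 1 := ⟨_, rfl⟩
  have hsK : r ^ s * K ≤ κ / 2 := by
    rw [lt_div_iff₀ hK0] at hs0
    have : r ^ s ≤ r ^ s0 := pow_le_pow_of_le_one hr0.le hr1.le (by omega)
    nlinarith
  refine ⟨max T1 T2 + s, s, by omega, fun i => φ ((Z ^ (i : ℕ)) g), ?_⟩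
  intro Y hY h0 a ha hrec t ht
  have main : ∀ s t, T1 ≤ t → T2 ≤ t →
      ‖a (t + s + 1) - ∑ i ∈ Finset.range s, Y (t + s - i) • (Z ^ i) g‖ ≤
        (r ^ s * K + κ / 2) * (|Y (t + s)| + D) := by
    intro s t h1 h2
    induction s with
    | zero =>
      simp only [Finset.range_zero, Finset.sum_empty, sub_zero, add_zero, pow_zero, one_mul]
      have := hbd Y hY h0 a ha hrec t h1
      have : 0 ≤ κ / 2 * (|Y t| + D) := by positivity
      linarith
    | succ s ih =>
      obtain ⟨hz, hgg⟩ := hT2 (t + s + 1) (by omega)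
      have e : a (t + (s + 1) + 1) - ∑ i ∈ Finset.range (s+1), Y (t + (s+1) - i) • (Z ^ i) g
          = Y (t + s + 1) • (gt (t + s + 1) - g) + (Zt (t+s+1) - Z) (a (t+s+1)) +
            Z (a (t + s + 1) - ∑ i ∈ Finset.range s, Y (t + s - i) • (Z ^ i) g) := by
        rw [Finset.sum_range_succ']
        have hsum : ∑ i ∈ Finset.range s, Y (t + (s+1) - (i+1)) • (Z ^ (i+1)) g
            = Z (∑ i ∈ Finset.range s, Y (t + s - i) • (Z ^ i) g) := by
          rw [map_sum]
          refine Finset.sum_congr rfl fun i _ => ?_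
          rw [map_smul, pow_succ', ← add_assoc, Nat.add_sub_add_right]
          rfl
        rw [hsum, ← add_assoc, hrec (t+s+1) (by omega)]
        simp only [pow_zero, one_apply_eq_self, tsub_zero, smul_sub, map_sub,
          _root_.sub_apply]
        abel
      rw [e, ← add_assoc]
      have hst := hstep Y hY (t + s)
      have hu0 : 0 ≤ |Y (t+s)| + D := by positivity
      have hu1 : 0 ≤ |Y (t+s+1)| + D := by positivity
      have e1 : ‖Y (t + s + 1) • (gt (t + s + 1) - g)‖ ≤ (|Y (t+s+1)| + D) * η := by
        rw [norm_smul, Real.norm_eq_abs]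
        exact mul_le_mul (by linarith) hgg (norm_nonneg _) hu1
      have e2 : ‖(Zt (t+s+1) - Z) (a (t+s+1))‖ ≤ η * (K * r / ρ * (|Y (t+s+1)| + D)) := by
        refine (ContinuousLinearMap.le_opNorm _ _).trans
          (mul_le_mul hz ?_ (norm_nonneg _) hη0.le)
        refine (hbd Y hY h0 a ha hrec (t+s) (by omega)).trans ?_
        have : |Y (t+s)| + D ≤ r * (|Y (t+s+1)| + D) / ρ := by
          rw [le_div_iff₀ hρ0]; linarith
        calc _ ≤ K * (r * (|Y (t+s+1)| + D) / ρ) := mul_le_mul_of_nonneg_left this hK0.le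
          _ = _ := by ring
      have e3 : ‖Z (a (t + s + 1) - ∑ i ∈ Finset.range s, Y (t + s - i) • (Z ^ i) g)‖ ≤
          (r ^ s * K + κ / 2) * (r * (|Y (t+s+1)| + D)) :=
        calc _ ≤ ‖Z‖ * _ := ContinuousLinearMap.le_opNorm _ _
          _ ≤ ρ * ((r ^ s * K + κ / 2) * (|Y (t + s)| + D)) :=
            mul_le_mul hρZ.le ih (norm_nonneg _) hρ0.le
          _ = (r ^ s * K + κ / 2) * (ρ * (|Y (t + s)| + D)) := by ring
          _ ≤ _ := mul_le_mul_of_nonneg_left hst (by positivity)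
      have e4 : (|Y (t+s+1)| + D) * η + η * (K * r / ρ * (|Y (t+s+1)| + D))
          = (κ / 2) * (1 - r) * (|Y (t+s+1)| + D) := by
        rw [← hηH, hH]; ring
      refine (norm_add₃_le).trans ?_
      calc _ ≤ (κ / 2) * (1 - r) * (|Y (t+s+1)| + D)
            + (r ^ s * K + κ / 2) * (r * (|Y (t+s+1)| + D)) := by linarith
        _ = _ := by ring
  obtain ⟨t', rfl⟩ : ∃ t', t = t' + s := ⟨t - s, by omega⟩
  have hm := main s t' (by omega) (by omega)
  have hval : φ (a (t' + s + 1)) - ∑ i : Fin s, φ ((Z ^ (i : ℕ)) g) * Y (t' + s - (i : ℕ)) =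
      φ (a (t' + s + 1) - ∑ i ∈ Finset.range s, Y (t' + s - i) • (Z ^ i) g) := by
    rw [Fin.sum_univ_eq_sum_range (fun i => φ ((Z ^ i) g) * Y (t' + s - i)) s, map_sub, map_sum]
    congr 1
    refine Finset.sum_congr rfl fun i _ => ?_
    rw [map_smul, smul_eq_mul, mul_comm]
  rw [hval, ← Real.norm_eq_abs]
  have hu : 0 ≤ |Y (t'+s)| + D := by positivity
  calc _ ≤ ‖φ‖ * _ := ContinuousLinearMap.le_opNorm _ _
    _ ≤ ‖φ‖ * (κ * (|Y (t'+s)| + D)) := by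
      refine mul_le_mul_of_nonneg_left (hm.trans ?_) (norm_nonneg _)
      exact mul_le_mul_of_nonneg_right (by linarith) hu
    _ = (‖φ‖ * κ) * |Y (t'+s)| + (‖φ‖ * κ) * D := by ring
    _ ≤ δ * |Y (t'+s)| + (ε / D) * D := 
      add_le_add (mul_le_mul_of_nonneg_right (hκφ.trans (min_le_left _ _)) (abs_nonneg _))
        (mul_le_mul_of_nonneg_right (hκφ.trans (min_le_right _ _)) hD0.le)
    _ = δ * |Y (t'+s)| + ε := by rw [div_mul_cancel₀ _ hD0.ne']
    _ ≤ _ := by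
      have := le_max_left ε (δ * |Y (t'+s)|)
      have := le_max_right ε (δ * |Y (t'+s)|)
      linarith

theorem quad_lt {n : ℕ} (G W R : Matrix (Fin n) (Fin n) ℝ) (F A : Fin n → ℝ) (v : ℝ) (hv : 0 < v)
    (hW : W.PosDef) (hR : R.PosSemidef)
    (hRic : R = G * (R - (F ⬝ᵥ (R *ᵥ F) + v)⁻¹ • vecMulVec (R *ᵥ F) (R *ᵥ F)) * Gᵀ + W)
    (hA : A = (F ⬝ᵥ (R *ᵥ F) + v)⁻¹ • (R *ᵥ F)) (x : Fin n → ℝ) (hx : x ≠ 0) :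
    ((G * (1 - vecMulVec A F))ᵀ *ᵥ x) ⬝ᵥ (R *ᵥ ((G * (1 - vecMulVec A F))ᵀ *ᵥ x)) <
      x ⬝ᵥ (R *ᵥ x) := by
  have hRT : Rᵀ = R := (conjTranspose_eq_transpose_of_trivial R).symm.trans hR.1
  have hF := hR.dotProduct_mulVec_nonneg F
  have hWx := hW.dotProduct_mulVec_pos hx
  simp only [star_trivial] at hF hWx
  obtain ⟨q, hq⟩ : ∃ q, q = F ⬝ᵥ (R *ᵥ F) + v := ⟨_, rfl⟩
  have hq0 : 0 < q := by linarith
  obtain ⟨k, hk⟩ : ∃ k, k = R *ᵥ F := ⟨_, rfl⟩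
  obtain ⟨y, hy⟩ : ∃ y, y = Gᵀ *ᵥ x := ⟨_, rfl⟩
  have h1 : x ⬝ᵥ (R *ᵥ x) = y ⬝ᵥ (R *ᵥ y) - q⁻¹ * (k ⬝ᵥ y)^2 + x ⬝ᵥ (W *ᵥ x) := by
    conv_lhs => rw [hRic]
    rw [add_mulVec, dotProduct_add, ← mulVec_mulVec, ← mulVec_mulVec, ← hy, ← hq, ← hk,
      dotProduct_mulVec x G, ← mulVec_transpose, ← hy, sub_mulVec, dotProduct_sub, smul_mulVec,
      dotProduct_smul, vecMulVec_mulVec]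
    simp only [op_smul_eq_smul, dotProduct_smul, smul_eq_mul, dotProduct_comm y k]
    ring
  have hz : (G * (1 - vecMulVec A F))ᵀ *ᵥ x = y - (A ⬝ᵥ y) • F := by
    rw [transpose_mul, ← mulVec_mulVec, ← hy, transpose_sub, transpose_one, transpose_vecMulVec,
      sub_mulVec, one_mulVec, vecMulVec_mulVec]
    simp
  have hyF : y ⬝ᵥ (R *ᵥ F) = k ⬝ᵥ y := by rw [hk, dotProduct_comm]
  have hFy : F ⬝ᵥ (R *ᵥ y) = k ⬝ᵥ y := by
    rw [hk, dotProduct_mulVec, ← mulVec_transpose, hRT]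
  have hAy : A ⬝ᵥ y = q⁻¹ * (k ⬝ᵥ y) := by rw [hA, ← hq, ← hk, smul_dotProduct, smul_eq_mul]
  rw [hz, h1, mulVec_sub, mulVec_smul, sub_dotProduct, dotProduct_sub, dotProduct_sub,
    smul_dotProduct, smul_dotProduct, dotProduct_smul, dotProduct_smul, hyF, hFy, hAy,
    show F ⬝ᵥ (R *ᵥ F) = q - v by linarith]
  simp only [smul_eq_mul]
  have e : y ⬝ᵥ (R *ᵥ y) - q⁻¹ * (k ⬝ᵥ y) * (k ⬝ᵥ y) - 
     (q⁻¹ * (k ⬝ᵥ y) * (k ⬝ᵥ y) - q⁻¹ * (k ⬝ᵥ y) * (q⁻¹ * (k ⬝ᵥ y) * (q - v))) =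
     y ⬝ᵥ (R *ᵥ y) - q⁻¹ * (k ⬝ᵥ y)^2 - v * (q⁻¹ * (k ⬝ᵥ y))^2 := by
    field_simp; ring
  rw [e]
  have : 0 ≤ v * (q⁻¹ * (k ⬝ᵥ y))^2 := by positivity
  linarith

theorem norm_lt_one {n : ℕ} (T : EuclideanSpace ℝ (Fin n) →L[ℝ] EuclideanSpace ℝ (Fin n))
    (h : ∀ x, x ≠ 0 → ‖T x‖ < ‖x‖) : ‖T‖ < 1 := by
  by_cases hne : (Metric.sphere (0 : EuclideanSpace ℝ (Fin n)) 1).Nonempty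
  · obtain ⟨x0, hx0, hmax⟩ := (isCompact_sphere (0 : EuclideanSpace ℝ (Fin n)) 1).exists_isMaxOn
      hne (f := fun x => ‖T x‖) (by fun_prop)
    have hx1 : ‖x0‖ = 1 := by simpa using hx0
    have hlt := h x0 (by rintro rfl; simp at hx1)
    refine lt_of_le_of_lt ?_ (hx1 ▸ hlt)
    refine T.opNorm_le_of_unit_norm (norm_nonneg _) fun x hx => ?_
    exact hmax (by simpa using hx)
  · have : T = 0 := by
      ext1 x
      by_contra hc
      have hx : x ≠ 0 := by rintro rfl; simp at hc
      exact hne ⟨‖x‖⁻¹ • x, by simp [norm_smul, hx]⟩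
    simp [this]

section
open scoped MatrixOrder Matrix.Norms.L2Operator
theorem exists_factor {n : ℕ} (R : Matrix (Fin n) (Fin n) ℝ) (hR : R.PosSemidef) :
    ∃ B : Matrix (Fin n) (Fin n) ℝ, R = Bᵀ * B := by
  obtain ⟨B, hB⟩ := CStarAlgebra.nonneg_iff_eq_star_mul_self.mp hR.nonneg
  refine ⟨B, ?_⟩
  rw [hB, star_eq_conjTranspose, conjTranspose_eq_transpose_of_trivial]
end

theorem exists_sim {n : ℕ} (Z R : Matrix (Fin n) (Fin n) ℝ) (hR : R.PosSemidef)
    (h : ∀ x, x ≠ 0 → (Zᵀ *ᵥ x) ⬝ᵥ (R *ᵥ (Zᵀ *ᵥ x)) < x ⬝ᵥ (R *ᵥ x)) :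
    ∃ S S' : Matrix (Fin n) (Fin n) ℝ, S * S' = 1 ∧ S' * S = 1 ∧
      ‖toEuclideanCLM (𝕜 := ℝ) (S' * Z * S)‖ < 1 := by
  obtain ⟨B, hB⟩ : ∃ B : Matrix (Fin n) (Fin n) ℝ, R = Bᵀ * B := by
    exact exists_factor R hR
  have hq : ∀ x, x ⬝ᵥ (R *ᵥ x) = (B *ᵥ x) ⬝ᵥ (B *ᵥ x) := by
    intro x
    rw [hB, ← mulVec_mulVec, dotProduct_mulVec, vecMul_transpose]
  have hn : ∀ x : EuclideanSpace ℝ (Fin n), ‖x‖^2 = x.ofLp ⬝ᵥ x.ofLp := by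
    intro x
    rw [EuclideanSpace.real_norm_sq_eq, dotProduct]
    simp [sq]
  have hinj : Function.Injective B.mulVec := by
    refine (injective_iff_map_eq_zero B.mulVecLin).2 fun x hx => ?_
    by_contra hc
    have h1 := h x hc
    have h2 := hR.dotProduct_mulVec_nonneg (Zᵀ *ᵥ x)
    have hx' : B *ᵥ x = 0 := hx
    rw [hq x, hx'] at h1
    simp only [star_trivial, dotProduct_zero] at h1 h2
    linarith
  have hU : IsUnit B := mulVec_injective_iff_isUnit.1 hinj
  have hd : IsUnit B.det := (isUnit_iff_isUnit_det B).1 hU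
  have hBB : B * B⁻¹ = 1 := mul_nonsing_inv B hd
  have hBB' : B⁻¹ * B = 1 := nonsing_inv_mul B hd
  refine ⟨Bᵀ, B⁻¹ᵀ, by rw [← transpose_mul, hBB', transpose_one],
    by rw [← transpose_mul, hBB, transpose_one], ?_⟩
  have hst : ‖toEuclideanCLM (𝕜 := ℝ) (B⁻¹ᵀ * Z * Bᵀ)‖ = ‖toEuclideanCLM (𝕜 := ℝ) (B * Zᵀ * B⁻¹)‖ := by
    rw [← norm_star, ← map_star]
    congr 2
    rw [star_eq_conjTranspose, conjTranspose_eq_transpose_of_trivial]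
    simp [transpose_mul, mul_assoc]
  rw [hst]
  refine norm_lt_one _ fun w hw => ?_
  refine lt_of_pow_lt_pow_left₀ 2 (norm_nonneg _) ?_
  rw [hn, hn, ofLp_toEuclideanCLM]
  have hw' : B *ᵥ (B⁻¹ *ᵥ w.ofLp) = w.ofLp := by rw [mulVec_mulVec, hBB, one_mulVec]
  have := h (B⁻¹ *ᵥ w.ofLp) (by
    intro hc
    rw [hc, mulVec_zero] at hw'
    exact hw (by ext i; simp [← hw']))
  rw [hq, hq, hw'] at this
  simpa only [mulVec_mulVec, ← mul_assoc] using this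

/-- LDS approximation, Lipschitz case: For the Kalman filter recursions
`R_t = G C_{t−1} Gᵀ + W`, `Q_t = ⟨F, R_t F⟩ + v`, `A_t = R_t F/Q_t`,
`C_t = R_t − Q_t A_t A_tᵀ`, `Z_t = G(I − A_t Fᵀ)` (for `t ≥ 1`, with `C_0` a symmetric
positive semidefinite initial covariance), `W` symmetric positive definite, `v > 0`,
assuming `R_t → R` entrywise with `R` a symmetric positive semidefinite solution of the
Riccati fixed-point equation: for any fixed `a_1`, every `ε, δ > 0` and `B_1 > 0`,
there exist `T_0`, `s ≥ 1` and `θ ∈ ℝˢ` such that for every sequence `Y` with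
`|Y_{t+1} − Y_t| ≤ B_1` and `|Y_0| ≤ B_1`, with `a_{t+1} = Y_t·G A_t + Z_t a_t` for
`t ≥ 1` and Kalman prediction `f_{t+1} := ⟨F, a_{t+1}⟩`, one has
`|f_{t+1} − Σ_{i<s} θ_i·Y_{t−i}| ≤ 2·max(ε, δ·|Y_t|)` for all `t ≥ T_0`. -/
theorem stmt_12 {n : ℕ} (hn : 1 ≤ n) (G W C0 : Matrix (Fin n) (Fin n) ℝ)
    (F a1 : Fin n → ℝ) (v : ℝ) (hv : 0 < v) (hW : W.PosDef) (hC0 : C0.PosSemidef)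
    (Rm Cm : ℕ → Matrix (Fin n) (Fin n) ℝ) (Qm : ℕ → ℝ)
    (Am : ℕ → Fin n → ℝ) (Zm : ℕ → Matrix (Fin n) (Fin n) ℝ)
    (hCm0 : Cm 0 = C0)
    (hRm : ∀ t, Rm (t + 1) = G * Cm t * Gᵀ + W)
    (hQm : ∀ t, Qm (t + 1) = F ⬝ᵥ (Rm (t + 1) *ᵥ F) + v)
    (hAm : ∀ t, Am (t + 1) = (Qm (t + 1))⁻¹ • (Rm (t + 1) *ᵥ F))
    (hCm : ∀ t, Cm (t + 1) =
      Rm (t + 1) - Qm (t + 1) • vecMulVec (Am (t + 1)) (Am (t + 1)))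
    (hZm : ∀ t, Zm (t + 1) = G * (1 - vecMulVec (Am (t + 1)) F))
    (R : Matrix (Fin n) (Fin n) ℝ)
    (hconv : ∀ i j, Tendsto (fun t => Rm t i j) atTop (nhds (R i j)))
    (hR : R.PosSemidef)
    (hRic : R = G * (R - (F ⬝ᵥ (R *ᵥ F) + v)⁻¹ • vecMulVec (R *ᵥ F) (R *ᵥ F)) * Gᵀ + W)
    (ε δ B1 : ℝ) (hε : 0 < ε) (hδ : 0 < δ) (hB1 : 0 < B1) :
    ∃ (T0 s : ℕ), 1 ≤ s ∧ ∃ θ : Fin s → ℝ,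
      ∀ Y : ℕ → ℝ, (∀ t, |Y (t + 1) - Y t| ≤ B1) → |Y 0| ≤ B1 →
      ∀ a : ℕ → Fin n → ℝ, a 1 = a1 →
        (∀ t, 1 ≤ t → a (t + 1) = Y t • (G *ᵥ Am t) + Zm t *ᵥ a t) →
      ∀ t : ℕ, T0 ≤ t →
        |F ⬝ᵥ a (t + 1) - ∑ i : Fin s, θ i * Y (t - (i : ℕ))|
          ≤ 2 * max ε (δ * |Y t|) := by
  have hRt : Tendsto Rm atTop (𝓝 R) := tendsto_pi_nhds.2 fun i => tendsto_pi_nhds.2 fun j => hconv i j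
  have hR1 : Tendsto (fun t => Rm (t + 1)) atTop (𝓝 R) := (tendsto_add_atTop_iff_nat 1).2 hRt
  have hRF : Tendsto (fun t => Rm (t + 1) *ᵥ F) atTop (𝓝 (R *ᵥ F)) :=
    ((continuous_id.matrix_mulVec continuous_const).tendsto R).comp hR1
  have hq0 : F ⬝ᵥ (R *ᵥ F) + v ≠ 0 := by
    have := hR.dotProduct_mulVec_nonneg F
    simp only [star_trivial] at this
    positivity
  have hQ : Tendsto (fun t => Qm (t + 1)) atTop (𝓝 (F ⬝ᵥ (R *ᵥ F) + v)) := by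
    simp only [hQm]
    exact (((continuous_const.dotProduct continuous_id).tendsto (R *ᵥ F)).comp hRF).add_const v
  obtain ⟨A, hA⟩ : ∃ A, A = (F ⬝ᵥ (R *ᵥ F) + v)⁻¹ • (R *ᵥ F) := ⟨_, rfl⟩
  have hA1 : Tendsto (fun t => Am (t + 1)) atTop (𝓝 A) := by
    simp only [hAm, hA]
    exact (hQ.inv₀ hq0).smul hRF
  have hAt : Tendsto Am atTop (𝓝 A) := (tendsto_add_atTop_iff_nat 1).1 hA1
  have hZt : Tendsto Zm atTop (𝓝 (G * (1 - vecMulVec A F))) := by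
    rw [← tendsto_add_atTop_iff_nat 1]
    simp only [hZm]
    have hc : Continuous fun x : Fin n → ℝ => G * (1 - vecMulVec x F) :=
      continuous_const.matrix_mul
        (continuous_const.sub (continuous_id.matrix_vecMulVec continuous_const))
    exact (hc.tendsto A).comp hA1
  obtain ⟨S, S', hS, hS', hlt⟩ := exists_sim (G * (1 - vecMulVec A F)) R hR
    (fun x hx => quad_lt G W R F A v hv hW hR hRic hA x hx)
  have hcT : Continuous fun M : Matrix (Fin n) (Fin n) ℝ => toEuclideanCLM (𝕜 := ℝ) (S' * M * S) := by
    have h1 : Continuous fun M : Matrix (Fin n) (Fin n) ℝ => toEuclideanCLM (𝕜 := ℝ) M :=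
      ((toEuclideanCLM (n := Fin n) (𝕜 := ℝ)).toAlgEquiv.toLinearMap).continuous_of_finiteDimensional
    exact h1.comp ((continuous_const.matrix_mul continuous_id).matrix_mul continuous_const)
  have hcg : Continuous fun x : Fin n → ℝ => WithLp.toLp 2 (S' *ᵥ (G *ᵥ x)) :=
    (PiLp.continuous_toLp 2 _).comp
      (continuous_const.matrix_mulVec (continuous_const.matrix_mulVec continuous_id))
  obtain ⟨T0, s, hs, θ, hθ⟩ := abs_lemma _ _ ((hcT.tendsto _).comp hZt) _ _
    ((hcg.tendsto A).comp hAt) hlt (innerSL ℝ (WithLp.toLp 2 (Sᵀ *ᵥ F)))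
    (WithLp.toLp 2 (S' *ᵥ a1)) ε δ B1 hε hδ hB1
  refine ⟨T0, s, hs, θ, fun Y hY h0 a ha hrec t ht => ?_⟩
  have := hθ Y hY h0 (fun t => WithLp.toLp 2 (S' *ᵥ a t)) (by simp [ha]) ?_ t ht
  · convert this using 3
    rw [innerSL_apply_apply, EuclideanSpace.inner_eq_star_dotProduct]
    simp only [star_trivial]
    rw [mulVec_transpose, dotProduct_comm (S' *ᵥ a (t + 1)), ← dotProduct_mulVec, mulVec_mulVec, hS, one_mulVec]
  · intro t ht
    simp only [Function.comp, hrec t ht, toEuclideanCLM_toLp, mulVec_add, mulVec_smul,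
      WithLp.toLp_add, WithLp.toLp_smul, mulVec_mulVec]
    rw [mul_assoc (S' * Zm t), hS, mul_one]
end
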